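/- arXiv:2210.00654 — 2 statements merged into one kernel-verified Lean document; each statement's English description precedes it below -/
import Mathlib

section
/- (Modalised deduction, forward direction.) Let H be a set of sequents of the form Λ → A with A product-free (built with \, /, ∧, 0, 1), and let Π → B be a product-free sequent. If Π → B is derivable from H in L^Λ(∧,0,1), then there exists a finite subset {Λ → A₁, …, Λ → Aₙ} ⊆ H such that the sequent !A₁, …, !Aₙ, Π → B is derivable (without hypotheses) in !L^Λ(∧,0,1). -/
/-- Formulae of the Lambek calculus with intersection, constants 0 and 1, and the
exponential modality `!`. -/
inductive Fm where
  | var : ℕ → Fm                -- propositional variable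
  | zero : Fm                   -- constant 0
  | one : Fm                    -- constant 1
  | mul : Fm → Fm → Fm          -- product A·B
  | ldiv : Fm → Fm → Fm         -- left division A\B
  | rdiv : Fm → Fm → Fm         -- right division B/A
  | inter : Fm → Fm → Fm        -- intersection A∧B
  | bang : Fm → Fm              -- exponential !A

/-- A formula is product-free if it is built from variables and the constants 0, 1
using only `\`, `/`, and `∧`. -/
def ProdFree : Fm → Prop
  | Fm.var _ => True
  | Fm.zero => True
  | Fm.one => True
  | Fm.mul _ _ => False
  | Fm.ldiv A B => ProdFree A ∧ ProdFree B
  | Fm.rdiv B A => ProdFree B ∧ ProdFree A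
  | Fm.inter A B => ProdFree A ∧ ProdFree B
  | Fm.bang _ => False

/-- Derivability of sequents in `L^Λ(∧,0,1)` from a set `H` of extra axioms. -/
inductive Deriv (H : Set (List Fm × Fm)) : List Fm → Fm → Prop
  | hyp {P B} : (P, B) ∈ H → Deriv H P B
  | id (A) : Deriv H [A] A
  | oneR : Deriv H [] Fm.one
  | zeroL (Γ Δ C) : Deriv H (Γ ++ [Fm.zero] ++ Δ) C
  | cut {P A Γ Δ C} : Deriv H P A → Deriv H (Γ ++ [A] ++ Δ) C →
      Deriv H (Γ ++ P ++ Δ) C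
  | ldivL {P A Γ B Δ C} : Deriv H P A → Deriv H (Γ ++ [B] ++ Δ) C →
      Deriv H (Γ ++ P ++ [Fm.ldiv A B] ++ Δ) C
  | ldivR {P A B} : Deriv H (A :: P) B → Deriv H P (Fm.ldiv A B)
  | rdivL {P A Γ B Δ C} : Deriv H P A → Deriv H (Γ ++ [B] ++ Δ) C →
      Deriv H (Γ ++ [Fm.rdiv B A] ++ P ++ Δ) C
  | rdivR {P A B} : Deriv H (P ++ [A]) B → Deriv H P (Fm.rdiv B A)
  | mulL {Γ A B Δ C} : Deriv H (Γ ++ [A, B] ++ Δ) C →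
      Deriv H (Γ ++ [Fm.mul A B] ++ Δ) C
  | mulR {P A Δ B} : Deriv H P A → Deriv H Δ B → Deriv H (P ++ Δ) (Fm.mul A B)
  | andL1 {Γ A B Δ C} : Deriv H (Γ ++ [A] ++ Δ) C →
      Deriv H (Γ ++ [Fm.inter A B] ++ Δ) C
  | andL2 {Γ A B Δ C} : Deriv H (Γ ++ [B] ++ Δ) C →
      Deriv H (Γ ++ [Fm.inter A B] ++ Δ) C
  | andR {P A B} : Deriv H P A → Deriv H P B → Deriv H P (Fm.inter A B)
  | oneL {Γ Δ C} : Deriv H (Γ ++ Δ) C → Deriv H (Γ ++ [Fm.one] ++ Δ) C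

/-- Pure derivability in `!L^Λ(∧,0,1)`: the exponential extension of `L^Λ(∧,0,1)`. -/
inductive BDeriv : List Fm → Fm → Prop
  | id (A) : BDeriv [A] A
  | oneR : BDeriv [] Fm.one
  | zeroL (Γ Δ C) : BDeriv (Γ ++ [Fm.zero] ++ Δ) C
  | cut {P A Γ Δ C} : BDeriv P A → BDeriv (Γ ++ [A] ++ Δ) C →
      BDeriv (Γ ++ P ++ Δ) C
  | ldivL {P A Γ B Δ C} : BDeriv P A → BDeriv (Γ ++ [B] ++ Δ) C →
      BDeriv (Γ ++ P ++ [Fm.ldiv A B] ++ Δ) C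
  | ldivR {P A B} : BDeriv (A :: P) B → BDeriv P (Fm.ldiv A B)
  | rdivL {P A Γ B Δ C} : BDeriv P A → BDeriv (Γ ++ [B] ++ Δ) C →
      BDeriv (Γ ++ [Fm.rdiv B A] ++ P ++ Δ) C
  | rdivR {P A B} : BDeriv (P ++ [A]) B → BDeriv P (Fm.rdiv B A)
  | mulL {Γ A B Δ C} : BDeriv (Γ ++ [A, B] ++ Δ) C →
      BDeriv (Γ ++ [Fm.mul A B] ++ Δ) C
  | mulR {P A Δ B} : BDeriv P A → BDeriv Δ B → BDeriv (P ++ Δ) (Fm.mul A B)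
  | andL1 {Γ A B Δ C} : BDeriv (Γ ++ [A] ++ Δ) C →
      BDeriv (Γ ++ [Fm.inter A B] ++ Δ) C
  | andL2 {Γ A B Δ C} : BDeriv (Γ ++ [B] ++ Δ) C →
      BDeriv (Γ ++ [Fm.inter A B] ++ Δ) C
  | andR {P A B} : BDeriv P A → BDeriv P B → BDeriv P (Fm.inter A B)
  | oneL {Γ Δ C} : BDeriv (Γ ++ Δ) C → BDeriv (Γ ++ [Fm.one] ++ Δ) C
  | bangL {Γ A Δ C} : BDeriv (Γ ++ [A] ++ Δ) C → BDeriv (Γ ++ [Fm.bang A] ++ Δ) C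
  | bangR {B} (As : List Fm) : BDeriv (List.map Fm.bang As) B → BDeriv (List.map Fm.bang As) (Fm.bang B)
  | bangW {Γ A Δ C} : BDeriv (Γ ++ Δ) C → BDeriv (Γ ++ [Fm.bang A] ++ Δ) C
  | bangP1 {Γ Φ A Δ C} : BDeriv (Γ ++ Φ ++ [Fm.bang A] ++ Δ) C →
      BDeriv (Γ ++ [Fm.bang A] ++ Φ ++ Δ) C
  | bangP2 {Γ Φ A Δ C} : BDeriv (Γ ++ [Fm.bang A] ++ Φ ++ Δ) C →
      BDeriv (Γ ++ Φ ++ [Fm.bang A] ++ Δ) C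
  | bangC {Γ A Δ C} : BDeriv (Γ ++ [Fm.bang A, Fm.bang A] ++ Δ) C →
      BDeriv (Γ ++ [Fm.bang A] ++ Δ) C

namespace BDeriv

theorem weaken_bangs {Γ Δ : List Fm} {C : Fm} (As : List Fm) (h : BDeriv (Γ ++ Δ) C) :
    BDeriv (Γ ++ As.map Fm.bang ++ Δ) C := by
  induction As with
  | nil => simpa using h
  | cons a As ih =>
    have := bangW (A := a) (Γ := Γ) (Δ := As.map Fm.bang ++ Δ) (by simpa using ih)
    simpa using this

theorem move_bangs_right {Γ Φ Δ : List Fm} {C : Fm} (As : List Fm)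
    (h : BDeriv (Γ ++ As.map Fm.bang ++ Φ ++ Δ) C) :
    BDeriv (Γ ++ Φ ++ As.map Fm.bang ++ Δ) C := by
  induction As generalizing Γ with
  | nil => simpa using h
  | cons a As ih =>
    have := bangP2 (Γ := Γ) (Φ := Φ) (A := a) (Δ := As.map Fm.bang ++ Δ)
      (by simpa using ih (Γ := Γ ++ [Fm.bang a]) (by simpa using h))
    simpa using this

theorem contract_bangs {Γ Φ Δ : List Fm} {C : Fm} (As : List Fm)
    (h : BDeriv (Γ ++ As.map Fm.bang ++ Φ ++ As.map Fm.bang ++ Δ) C) :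
    BDeriv (Γ ++ As.map Fm.bang ++ Φ ++ Δ) C := by
  induction As generalizing Γ with
  | nil => simpa using h
  | cons a As ih =>
    have h₁ := bangP1 (Γ := Γ ++ [Fm.bang a]) (Φ := As.map Fm.bang ++ Φ) (A := a)
      (Δ := As.map Fm.bang ++ Δ) (by simpa using h)
    have h₂ := bangC (Γ := Γ) (A := a)
      (Δ := As.map Fm.bang ++ Φ ++ As.map Fm.bang ++ Δ) (by simpa using h₁)
    simpa using ih (Γ := Γ ++ [Fm.bang a]) (by simpa using h₂)

end BDeriv

/-- `B` follows from `P` and finitely many banged formulae that are hypotheses in `H`. -/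
def BangDeriv (H : Set (List Fm × Fm)) (P : List Fm) (B : Fm) : Prop :=
  ∃ As : List Fm, (∀ A ∈ As, (([] : List Fm), A) ∈ H) ∧ BDeriv (As.map Fm.bang ++ P) B

namespace BangDeriv

variable {H : Set (List Fm × Fm)} {P Q R : List Fm} {A B C : Fm}

theorem of_bDeriv (h : BDeriv P B) : BangDeriv H P B := ⟨[], by simp, by simpa using h⟩

theorem map (h : BangDeriv H P A)
    (f : ∀ As : List Fm, BDeriv (As.map Fm.bang ++ P) A → BDeriv (As.map Fm.bang ++ R) C) :
    BangDeriv H R C :=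
  let ⟨As, hAs, h⟩ := h
  ⟨As, hAs, f As h⟩

theorem map₂ (h₁ : BangDeriv H P A) (h₂ : BangDeriv H Q B)
    (f : ∀ As : List Fm, BDeriv (As.map Fm.bang ++ P) A → BDeriv (As.map Fm.bang ++ Q) B →
      BDeriv (As.map Fm.bang ++ R) C) :
    BangDeriv H R C := by
  obtain ⟨As₁, hAs₁, h₁⟩ := h₁
  obtain ⟨As₂, hAs₂, h₂⟩ := h₂
  refine ⟨As₁ ++ As₂, ?_, f _ ?_ ?_⟩
  · intro A hA
    exact (List.mem_append.mp hA).elim (hAs₁ A) (hAs₂ A)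
  · simpa using h₁.weaken_bangs As₂
  · simpa using BDeriv.weaken_bangs (Γ := []) As₁ h₂

end BangDeriv

theorem Deriv.bangDeriv {H : Set (List Fm × Fm)} (hH : ∀ s ∈ H, s.1 = []) {P : List Fm} {B : Fm}
    (h : Deriv H P B) : BangDeriv H P B := by
  induction h with
  | @hyp P B h =>
    obtain rfl : P = [] := hH _ h
    exact ⟨[B], by simpa using h, .bangL (Γ := []) (Δ := []) (.id B)⟩
  | id A => exact .of_bDeriv (.id A)
  | oneR => exact .of_bDeriv .oneR
  | zeroL Γ Δ C => exact .of_bDeriv (.zeroL Γ Δ C)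
  | @cut P A Γ Δ C _ _ ih₁ ih₂ =>
    refine ih₁.map₂ ih₂ fun As h₁ h₂ => ?_
    have := BDeriv.cut (Γ := As.map Fm.bang ++ Γ) (Δ := Δ) h₁ (by simpa using h₂)
    simpa using BDeriv.contract_bangs (Γ := []) (Φ := Γ) (Δ := P ++ Δ) As (by simpa using this)
  | @ldivL P A Γ B Δ C _ _ ih₁ ih₂ =>
    refine ih₁.map₂ ih₂ fun As h₁ h₂ => ?_
    have := BDeriv.ldivL (Γ := As.map Fm.bang ++ Γ) (Δ := Δ) (B := B) h₁ (by simpa using h₂)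
    simpa using BDeriv.contract_bangs (Γ := []) (Φ := Γ) (Δ := P ++ [Fm.ldiv A B] ++ Δ) As
      (by simpa using this)
  | @ldivR P A B _ ih =>
    refine ih.map fun As h => .ldivR ?_
    simpa using BDeriv.move_bangs_right (Γ := []) (Φ := [A]) (Δ := P) As (by simpa using h)
  | @rdivL P A Γ B Δ C _ _ ih₁ ih₂ =>
    refine ih₁.map₂ ih₂ fun As h₁ h₂ => ?_
    have := BDeriv.rdivL (Γ := As.map Fm.bang ++ Γ) (Δ := Δ) (B := B) h₁ (by simpa using h₂)
    simpa using BDeriv.contract_bangs (Γ := []) (Φ := Γ ++ [Fm.rdiv B A]) (Δ := P ++ Δ) As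
      (by simpa using this)
  | rdivR _ ih => exact ih.map fun As h => .rdivR (by simpa using h)
  | @mulL Γ A B Δ C _ ih =>
    refine ih.map fun As h => ?_
    simpa using BDeriv.mulL (Γ := As.map Fm.bang ++ Γ) (A := A) (B := B) (Δ := Δ)
      (by simpa using h)
  | @mulR P A Δ B _ _ ih₁ ih₂ =>
    refine ih₁.map₂ ih₂ fun As h₁ h₂ => ?_
    simpa using BDeriv.contract_bangs (Γ := []) (Φ := P) (Δ := Δ) As
      (by simpa using h₁.mulR h₂)
  | @andL1 Γ A B Δ C _ ih =>
    refine ih.map fun As h => ?_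
    simpa using BDeriv.andL1 (Γ := As.map Fm.bang ++ Γ) (A := A) (B := B) (Δ := Δ)
      (by simpa using h)
  | @andL2 Γ A B Δ C _ ih =>
    refine ih.map fun As h => ?_
    simpa using BDeriv.andL2 (Γ := As.map Fm.bang ++ Γ) (A := A) (B := B) (Δ := Δ)
      (by simpa using h)
  | andR _ _ ih₁ ih₂ => exact ih₁.map₂ ih₂ fun _ h₁ h₂ => .andR h₁ h₂
  | @oneL Γ Δ C _ ih =>
    refine ih.map fun As h => ?_
    simpa using BDeriv.oneL (Γ := As.map Fm.bang ++ Γ) (Δ := Δ) (by simpa using h)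

/-- Modalised deduction theorem, forward direction: if `H` is a set of sequents of the
form `Λ → A` with `A` product-free, `Π → B` is product-free, and `Π → B` is derivable
from `H` in `L^Λ(∧,0,1)`, then for some finite list `A₁, …, Aₙ` of formulae with
`Λ → Aᵢ ∈ H`, the sequent `!A₁, …, !Aₙ, Π → B` is derivable in `!L^Λ(∧,0,1)`. -/
theorem modalised_deduction_forward (H : Set (List Fm × Fm))
    (hH : ∀ s ∈ H, s.1 = [] ∧ ProdFree s.2)
    (P : List Fm) (B : Fm)
    (hP : ∀ A ∈ P, ProdFree A) (hB : ProdFree B)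
    (h : Deriv H P B) :
    ∃ As : List Fm, (∀ A ∈ As, (([] : List Fm), A) ∈ H) ∧
      BDeriv (List.map Fm.bang As ++ P) B :=
  h.bangDeriv fun s hs => (hH s hs).1
end

section
/- (Modalised deduction, backward direction.) Let A₁, …, Aₙ and the sequent Π → B be product-free (built with \, /, ∧, 0, 1). If the sequent !A₁, …, !Aₙ, Π → B is derivable in !L^Λ(∧,0,1), then Π → B is derivable from the hypotheses {Λ → A₁, …, Λ → Aₙ} in the product-free fragment L^Λ_{\,/}(∧,0,1). Moreover, if A₁, …, Aₙ, Π, B contain no constants 0 and 1, then Π → B is derivable from these hypotheses in L^Λ_{\,/}(∧). -/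
/-- A formula contains no constants 0 and 1 (and no `!`, staying in the basic
language). -/
def ConstFree : Fm → Prop
  | Fm.var _ => True
  | Fm.zero => False
  | Fm.one => False
  | Fm.mul A B => ConstFree A ∧ ConstFree B
  | Fm.ldiv A B => ConstFree A ∧ ConstFree B
  | Fm.rdiv B A => ConstFree B ∧ ConstFree A
  | Fm.inter A B => ConstFree A ∧ ConstFree B
  | Fm.bang _ => False

/-- Derivability from hypotheses `H` in the product-free fragment `L^Λ_{\,/}(∧,0,1)`:
the rules of `L^Λ(∧,0,1)` without `·L` and `·R`. -/
inductive DerivPF (H : Set (List Fm × Fm)) : List Fm → Fm → Prop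
  | hyp {P B} : (P, B) ∈ H → DerivPF H P B
  | id (A) : DerivPF H [A] A
  | oneR : DerivPF H [] Fm.one
  | zeroL (Γ Δ C) : DerivPF H (Γ ++ [Fm.zero] ++ Δ) C
  | cut {P A Γ Δ C} : DerivPF H P A → DerivPF H (Γ ++ [A] ++ Δ) C →
      DerivPF H (Γ ++ P ++ Δ) C
  | ldivL {P A Γ B Δ C} : DerivPF H P A → DerivPF H (Γ ++ [B] ++ Δ) C →
      DerivPF H (Γ ++ P ++ [Fm.ldiv A B] ++ Δ) C
  | ldivR {P A B} : DerivPF H (A :: P) B → DerivPF H P (Fm.ldiv A B)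
  | rdivL {P A Γ B Δ C} : DerivPF H P A → DerivPF H (Γ ++ [B] ++ Δ) C →
      DerivPF H (Γ ++ [Fm.rdiv B A] ++ P ++ Δ) C
  | rdivR {P A B} : DerivPF H (P ++ [A]) B → DerivPF H P (Fm.rdiv B A)
  | andL1 {Γ A B Δ C} : DerivPF H (Γ ++ [A] ++ Δ) C →
      DerivPF H (Γ ++ [Fm.inter A B] ++ Δ) C
  | andL2 {Γ A B Δ C} : DerivPF H (Γ ++ [B] ++ Δ) C →
      DerivPF H (Γ ++ [Fm.inter A B] ++ Δ) C
  | andR {P A B} : DerivPF H P A → DerivPF H P B → DerivPF H P (Fm.inter A B)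
  | oneL {Γ Δ C} : DerivPF H (Γ ++ Δ) C → DerivPF H (Γ ++ [Fm.one] ++ Δ) C

/-- Derivability from hypotheses `H` in the product-free, constant-free fragment
`L^Λ_{\,/}(∧)`: additionally without the axioms/rules `1R`, `1L`, `0L`. -/
inductive DerivPFNC (H : Set (List Fm × Fm)) : List Fm → Fm → Prop
  | hyp {P B} : (P, B) ∈ H → DerivPFNC H P B
  | id (A) : DerivPFNC H [A] A
  | cut {P A Γ Δ C} : DerivPFNC H P A → DerivPFNC H (Γ ++ [A] ++ Δ) C →
      DerivPFNC H (Γ ++ P ++ Δ) C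
  | ldivL {P A Γ B Δ C} : DerivPFNC H P A → DerivPFNC H (Γ ++ [B] ++ Δ) C →
      DerivPFNC H (Γ ++ P ++ [Fm.ldiv A B] ++ Δ) C
  | ldivR {P A B} : DerivPFNC H (A :: P) B → DerivPFNC H P (Fm.ldiv A B)
  | rdivL {P A Γ B Δ C} : DerivPFNC H P A → DerivPFNC H (Γ ++ [B] ++ Δ) C →
      DerivPFNC H (Γ ++ [Fm.rdiv B A] ++ P ++ Δ) C
  | rdivR {P A B} : DerivPFNC H (P ++ [A]) B → DerivPFNC H P (Fm.rdiv B A)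
  | andL1 {Γ A B Δ C} : DerivPFNC H (Γ ++ [A] ++ Δ) C →
      DerivPFNC H (Γ ++ [Fm.inter A B] ++ Δ) C
  | andL2 {Γ A B Δ C} : DerivPFNC H (Γ ++ [B] ++ Δ) C →
      DerivPFNC H (Γ ++ [Fm.inter A B] ++ Δ) C
  | andR {P A B} : DerivPFNC H P A → DerivPFNC H P B → DerivPFNC H P (Fm.inter A B)

/-- The closure of a set of contexts in the syntactic phase space of the relation `D`. -/
def phaseClosure (D : List Fm → Fm → Prop) (X : Set (List Fm)) : Set (List Fm) :=
  {Γ | ∀ L R C, (∀ Δ ∈ X, D (L ++ Δ ++ R) C) → D (L ++ Γ ++ R) C}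

/-- The interpretation of formulae in the syntactic phase space of `D`. The formula `!A` denotes
the unit if the empty context belongs to the denotation of `A`, and the bottom otherwise. -/
def interp (D : List Fm → Fm → Prop) : Fm → Set (List Fm)
  | Fm.var n => {Γ | D Γ (Fm.var n)}
  | Fm.zero => phaseClosure D ∅
  | Fm.one => phaseClosure D {[]}
  | Fm.mul A B => phaseClosure D {Γ | ∃ a ∈ interp D A, ∃ b ∈ interp D B, Γ = a ++ b}
  | Fm.ldiv A B => {Γ | ∀ a ∈ interp D A, a ++ Γ ∈ interp D B}
  | Fm.rdiv B A => {Γ | ∀ a ∈ interp D A, Γ ++ a ∈ interp D B}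
  | Fm.inter A B => interp D A ∩ interp D B
  | Fm.bang A => phaseClosure D {Γ | Γ = [] ∧ [] ∈ interp D A}

/-- The interpretation of a context: concatenations of members of its formulae. -/
def interpCtx (D : List Fm → Fm → Prop) : List Fm → Set (List Fm)
  | [] => {[]}
  | A :: Γ => {δ | ∃ a ∈ interp D A, ∃ b ∈ interpCtx D Γ, δ = a ++ b}

/-- A set of contexts is stable if membership of `L, x, R` extends from `x ∈ X` to the closure
of `X`. -/
def PhaseStable (D : List Fm → Fm → Prop) (S : Set (List Fm)) : Prop :=
  ∀ (X : Set (List Fm)) (L R : List Fm), (∀ x ∈ X, L ++ x ++ R ∈ S) →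
    ∀ x ∈ phaseClosure D X, L ++ x ++ R ∈ S

theorem subset_phaseClosure (D : List Fm → Fm → Prop) (X : Set (List Fm)) :
    X ⊆ phaseClosure D X :=
  fun x hx _ _ _ h => h x hx

theorem phaseStable_phaseClosure (D : List Fm → Fm → Prop) (Y : Set (List Fm)) :
    PhaseStable D (phaseClosure D Y) := by
  intro X L R h x hx L' R' C hY
  have := hx (L' ++ L) (R ++ R') C fun y hy => by
    simpa using h y hy L' R' C hY
  simpa using this

theorem phaseStable_interp (D : List Fm → Fm → Prop) (A : Fm) : PhaseStable D (interp D A) := by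
  induction A with
  | var n =>
    intro X L R h x hx
    exact hx L R _ h
  | zero => exact phaseStable_phaseClosure D _
  | one => exact phaseStable_phaseClosure D _
  | mul A B => exact phaseStable_phaseClosure D _
  | bang A => exact phaseStable_phaseClosure D _
  | ldiv A B _ ihB =>
    intro X L R h x hx a ha
    have := ihB X (a ++ L) R (fun y hy => by simpa using h y hy a ha) x hx
    simpa using this
  | rdiv B A ihB _ =>
    intro X L R h x hx a ha
    have := ihB X L (R ++ a) (fun y hy => by simpa using h y hy a ha) x hx
    simpa using this
  | inter A B ihA ihB =>
    intro X L R h x hx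
    exact ⟨ihA X L R (fun y hy => (h y hy).1) x hx, ihB X L R (fun y hy => (h y hy).2) x hx⟩

theorem mem_interpCtx_append {D : List Fm → Fm → Prop} {Γ Δ δ : List Fm} :
    δ ∈ interpCtx D (Γ ++ Δ) ↔
      ∃ a ∈ interpCtx D Γ, ∃ b ∈ interpCtx D Δ, δ = a ++ b := by
  induction Γ generalizing δ with
  | nil => simp [interpCtx]
  | cons A Γ ih =>
    constructor
    · rintro ⟨a, ha, b, hb, rfl⟩
      obtain ⟨c, hc, d, hd, rfl⟩ := ih.1 hb
      exact ⟨a ++ c, ⟨a, ha, c, hc, rfl⟩, d, hd, by simp⟩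
    · rintro ⟨_, ⟨a, ha, c, hc, rfl⟩, d, hd, rfl⟩
      exact ⟨a, ha, c ++ d, ih.2 ⟨c, hc, d, hd, rfl⟩, by simp⟩

theorem mem_interpCtx_singleton {D : List Fm → Fm → Prop} {A : Fm} {δ : List Fm} :
    δ ∈ interpCtx D [A] ↔ δ ∈ interp D A := by
  simp [interpCtx]

theorem append_mem_interpCtx {D : List Fm → Fm → Prop} {Γ Δ a b : List Fm}
    (ha : a ∈ interpCtx D Γ) (hb : b ∈ interpCtx D Δ) : a ++ b ∈ interpCtx D (Γ ++ Δ) :=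
  mem_interpCtx_append.2 ⟨a, ha, b, hb, rfl⟩

theorem mem_interpCtx_middle {D : List Fm → Fm → Prop} {Γ Φ Δ δ : List Fm} :
    δ ∈ interpCtx D (Γ ++ Φ ++ Δ) ↔
      ∃ l ∈ interpCtx D Γ, ∃ x ∈ interpCtx D Φ, ∃ r ∈ interpCtx D Δ, δ = l ++ x ++ r := by
  constructor
  · intro h
    obtain ⟨_, hlx, r, hr, rfl⟩ := mem_interpCtx_append.1 h
    obtain ⟨l, hl, x, hx, rfl⟩ := mem_interpCtx_append.1 hlx
    exact ⟨l, hl, x, hx, r, hr, rfl⟩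
  · rintro ⟨l, hl, x, hx, r, hr, rfl⟩
    exact append_mem_interpCtx (append_mem_interpCtx hl hx) hr

/-- To show that a context of `!`-formulae is contained in a stable set, it suffices to consider
the empty context. -/
theorem interpCtx_map_bang_subset {D : List Fm → Fm → Prop} (As : List Fm) {S : Set (List Fm)}
    (hS : PhaseStable D S) (h : [] ∈ interpCtx D (As.map Fm.bang) → [] ∈ S) :
    interpCtx D (As.map Fm.bang) ⊆ S := by
  induction As with
  | nil =>
    rintro _ rfl
    exact h rfl
  | cons A As ih =>
    rintro _ ⟨a, ha, b, hb, rfl⟩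
    refine hS _ [] b ?_ a ha
    rintro _ ⟨rfl, hA⟩
    exact ih (fun hn => h ⟨[], subset_phaseClosure D _ ⟨rfl, hA⟩, [], hn, rfl⟩) hb

/-- Soundness of `!L^Λ(∧,0,1)` in the syntactic phase space of an arbitrary relation. -/
theorem BDeriv.sound (D : List Fm → Fm → Prop) {Γ : List Fm} {C : Fm} (h : BDeriv Γ C) :
    interpCtx D Γ ⊆ interp D C := by
  induction h with
  | id A => exact fun δ h => mem_interpCtx_singleton.1 h
  | oneR => exact subset_phaseClosure D _
  | zeroL Γ Δ C =>
    intro δ h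
    obtain ⟨l, hl, x, hx, r, hr, rfl⟩ := mem_interpCtx_middle.1 h
    exact phaseStable_interp D C ∅ l r (by simp) x (mem_interpCtx_singleton.1 hx)
  | cut _ _ ih₁ ih₂ =>
    intro δ h
    obtain ⟨l, hl, x, hx, r, hr, rfl⟩ := mem_interpCtx_middle.1 h
    exact ih₂ (mem_interpCtx_middle.2
      ⟨l, hl, x, mem_interpCtx_singleton.2 (ih₁ hx), r, hr, rfl⟩)
  | ldivL _ _ ih₁ ih₂ =>
    intro δ h
    obtain ⟨_, hlp, x, hx, r, hr, rfl⟩ := mem_interpCtx_middle.1 h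
    obtain ⟨l, hl, p, hp, rfl⟩ := mem_interpCtx_append.1 hlp
    have := ih₂ (mem_interpCtx_middle.2 ⟨l, hl, p ++ x, mem_interpCtx_singleton.2
      (mem_interpCtx_singleton.1 hx p (ih₁ hp)), r, hr, rfl⟩)
    simpa using this
  | ldivR _ ih =>
    intro δ h a ha
    exact ih ⟨a, ha, δ, h, rfl⟩
  | rdivL _ _ ih₁ ih₂ =>
    intro δ h
    obtain ⟨_, hlx, r, hr, rfl⟩ := mem_interpCtx_append.1 h
    obtain ⟨l, hl, x, hx, p, hp, rfl⟩ := mem_interpCtx_middle.1 hlx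
    have := ih₂ (mem_interpCtx_middle.2 ⟨l, hl, x ++ p, mem_interpCtx_singleton.2
      (mem_interpCtx_singleton.1 hx p (ih₁ hp)), r, hr, rfl⟩)
    simpa using this
  | rdivR _ ih =>
    intro δ h a ha
    exact ih (append_mem_interpCtx h (mem_interpCtx_singleton.2 ha))
  | @mulL Γ A B Δ C _ ih =>
    intro δ h
    obtain ⟨l, hl, x, hx, r, hr, rfl⟩ := mem_interpCtx_middle.1 h
    refine phaseStable_interp D C _ l r ?_ x (mem_interpCtx_singleton.1 hx)
    rintro _ ⟨a, ha, b, hb, rfl⟩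
    exact ih (mem_interpCtx_middle.2
      ⟨l, hl, _, ⟨a, ha, b, mem_interpCtx_singleton.2 hb, rfl⟩, r, hr, rfl⟩)
  | mulR _ _ ih₁ ih₂ =>
    intro δ h
    obtain ⟨a, ha, b, hb, rfl⟩ := mem_interpCtx_append.1 h
    exact subset_phaseClosure D _ ⟨a, ih₁ ha, b, ih₂ hb, rfl⟩
  | andL1 _ ih =>
    intro δ h
    obtain ⟨l, hl, x, hx, r, hr, rfl⟩ := mem_interpCtx_middle.1 h
    exact ih (mem_interpCtx_middle.2
      ⟨l, hl, x, mem_interpCtx_singleton.2 (mem_interpCtx_singleton.1 hx).1, r, hr, rfl⟩)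
  | andL2 _ ih =>
    intro δ h
    obtain ⟨l, hl, x, hx, r, hr, rfl⟩ := mem_interpCtx_middle.1 h
    exact ih (mem_interpCtx_middle.2
      ⟨l, hl, x, mem_interpCtx_singleton.2 (mem_interpCtx_singleton.1 hx).2, r, hr, rfl⟩)
  | andR _ _ ih₁ ih₂ => exact fun δ h => ⟨ih₁ h, ih₂ h⟩
  | @oneL Γ Δ C _ ih =>
    intro δ h
    obtain ⟨l, hl, x, hx, r, hr, rfl⟩ := mem_interpCtx_middle.1 h
    refine phaseStable_interp D C _ l r ?_ x (mem_interpCtx_singleton.1 hx)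
    rintro _ rfl
    simpa using ih (append_mem_interpCtx hl hr)
  | @bangL Γ A Δ C _ ih =>
    intro δ h
    obtain ⟨l, hl, x, hx, r, hr, rfl⟩ := mem_interpCtx_middle.1 h
    refine phaseStable_interp D C _ l r ?_ x (mem_interpCtx_singleton.1 hx)
    rintro _ ⟨rfl, hA⟩
    exact ih (mem_interpCtx_middle.2 ⟨l, hl, [], mem_interpCtx_singleton.2 hA, r, hr, rfl⟩)
  | @bangR B As _ ih =>
    exact interpCtx_map_bang_subset As (phaseStable_interp D _)
      fun hn => subset_phaseClosure D _ ⟨rfl, ih hn⟩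
  | @bangW Γ A Δ C _ ih =>
    intro δ h
    obtain ⟨l, hl, x, hx, r, hr, rfl⟩ := mem_interpCtx_middle.1 h
    refine phaseStable_interp D C _ l r ?_ x (mem_interpCtx_singleton.1 hx)
    rintro _ ⟨rfl, -⟩
    simpa using ih (append_mem_interpCtx hl hr)
  | @bangP1 Γ Φ A Δ C _ ih =>
    intro δ h
    obtain ⟨_, hlx, r, hr, rfl⟩ := mem_interpCtx_append.1 h
    obtain ⟨l, hl, x, hx, p, hp, rfl⟩ := mem_interpCtx_middle.1 hlx
    have := phaseStable_interp D C _ l (p ++ r) ?_ x (mem_interpCtx_singleton.1 hx)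
    · simpa using this
    rintro _ ⟨rfl, hA⟩
    have := ih (append_mem_interpCtx (append_mem_interpCtx (append_mem_interpCtx hl hp)
      (mem_interpCtx_singleton.2 (subset_phaseClosure D _ ⟨rfl, hA⟩))) hr)
    simpa using this
  | @bangP2 Γ Φ A Δ C _ ih =>
    intro δ h
    obtain ⟨lp, hlp, x, hx, r, hr, rfl⟩ := mem_interpCtx_middle.1 h
    obtain ⟨l, hl, p, hp, rfl⟩ := mem_interpCtx_append.1 hlp
    refine phaseStable_interp D C _ (l ++ p) r ?_ x (mem_interpCtx_singleton.1 hx)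
    rintro _ ⟨rfl, hA⟩
    have := ih (append_mem_interpCtx (append_mem_interpCtx (append_mem_interpCtx hl
      (mem_interpCtx_singleton.2 (subset_phaseClosure D _ ⟨rfl, hA⟩))) hp) hr)
    simpa using this
  | @bangC Γ A Δ C _ ih =>
    intro δ h
    obtain ⟨l, hl, x, hx, r, hr, rfl⟩ := mem_interpCtx_middle.1 h
    refine phaseStable_interp D C _ l r ?_ x (mem_interpCtx_singleton.1 hx)
    rintro _ ⟨rfl, hA⟩
    have hb : [] ∈ interp D (Fm.bang A) := subset_phaseClosure D _ ⟨rfl, hA⟩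
    exact ih (mem_interpCtx_middle.2
      ⟨l, hl, [], ⟨[], hb, [], mem_interpCtx_singleton.2 hb, rfl⟩, r, hr, rfl⟩)

/-- In the phase space of a relation closed under the rules of `L^Λ_{\,/}(∧)`, and under the rules
for the constants if these occur, a product-free formula denotes the set of contexts deriving
it. -/
theorem mem_interp_iff {D : List Fm → Fm → Prop} (id : ∀ A, D [A] A)
    (cut : ∀ {P A Γ Δ C}, D P A → D (Γ ++ [A] ++ Δ) C → D (Γ ++ P ++ Δ) C)
    (ldivL : ∀ {P A Γ B Δ C}, D P A → D (Γ ++ [B] ++ Δ) C →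
      D (Γ ++ P ++ [Fm.ldiv A B] ++ Δ) C)
    (ldivR : ∀ {P A B}, D (A :: P) B → D P (Fm.ldiv A B))
    (rdivL : ∀ {P A Γ B Δ C}, D P A → D (Γ ++ [B] ++ Δ) C →
      D (Γ ++ [Fm.rdiv B A] ++ P ++ Δ) C)
    (rdivR : ∀ {P A B}, D (P ++ [A]) B → D P (Fm.rdiv B A))
    (andL1 : ∀ {Γ A B Δ C}, D (Γ ++ [A] ++ Δ) C → D (Γ ++ [Fm.inter A B] ++ Δ) C)
    (andL2 : ∀ {Γ A B Δ C}, D (Γ ++ [B] ++ Δ) C → D (Γ ++ [Fm.inter A B] ++ Δ) C)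
    (andR : ∀ {P A B}, D P A → D P B → D P (Fm.inter A B)) {A : Fm}
    (const : ConstFree A ∨ D [] Fm.one ∧ (∀ Γ Δ C, D (Γ ++ [Fm.zero] ++ Δ) C) ∧
      ∀ {Γ Δ C}, D (Γ ++ Δ) C → D (Γ ++ [Fm.one] ++ Δ) C)
    (hA : ProdFree A) {Γ : List Fm} : Γ ∈ interp D A ↔ D Γ A := by
  induction A generalizing Γ with
  | var n => exact Iff.rfl
  | zero =>
    obtain h | ⟨-, zeroL, -⟩ := const
    · exact h.elim
    · exact ⟨fun h => by simpa using h [] [] Fm.zero (by simp),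
        fun h L R C _ => cut h (zeroL L R C)⟩
  | one =>
    obtain h | ⟨oneR, -, oneL⟩ := const
    · exact h.elim
    · refine ⟨fun h => by simpa using h [] [] Fm.one (by simpa using oneR),
        fun h L R C hC => cut h (oneL ?_)⟩
      simpa using hC [] rfl
  | mul A B => exact hA.elim
  | bang A => exact hA.elim
  | ldiv A B ihA ihB =>
    replace ihA := @ihA (const.imp_left And.left) hA.1
    replace ihB := @ihB (const.imp_left And.right) hA.2
    refine ⟨fun h => ldivR (ihB.1 (h [A] (ihA.2 (id A)))), fun h a ha => ihB.2 ?_⟩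
    have := cut (Γ := a) (Δ := []) h
      (by simpa using ldivL (Γ := []) (Δ := []) (ihA.1 ha) (id B))
    simpa using this
  | rdiv B A ihB ihA =>
    replace ihB := @ihB (const.imp_left And.left) hA.1
    replace ihA := @ihA (const.imp_left And.right) hA.2
    refine ⟨fun h => rdivR (ihB.1 (h [A] (ihA.2 (id A)))), fun h a ha => ihB.2 ?_⟩
    have := cut (Γ := []) (Δ := a) h
      (by simpa using rdivL (Γ := []) (Δ := []) (ihA.1 ha) (id B))
    simpa using this
  | inter A B ihA ihB =>
    replace ihA := @ihA (const.imp_left And.left) hA.1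
    replace ihB := @ihB (const.imp_left And.right) hA.2
    refine ⟨fun h => andR (ihA.1 h.1) (ihB.1 h.2), fun h => ⟨ihA.2 ?_, ihB.2 ?_⟩⟩
    · simpa using cut (Γ := []) (Δ := []) h (andL1 (id A))
    · simpa using cut (Γ := []) (Δ := []) h (andL2 (id B))

theorem self_mem_interpCtx {D : List Fm → Fm → Prop} {P : List Fm}
    (h : ∀ A ∈ P, [A] ∈ interp D A) : P ∈ interpCtx D P := by
  induction P with
  | nil => rfl
  | cons A P ih =>
    exact ⟨[A], h A (by simp), P, ih fun B hB => h B (by simp [hB]), rfl⟩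

theorem nil_mem_interpCtx_map_bang {D : List Fm → Fm → Prop} {As : List Fm}
    (h : ∀ A ∈ As, [] ∈ interp D A) : [] ∈ interpCtx D (As.map Fm.bang) := by
  induction As with
  | nil => rfl
  | cons A As ih =>
    exact ⟨[], subset_phaseClosure D _ ⟨rfl, h A (by simp)⟩, [],
      ih fun B hB => h B (by simp [hB]), rfl⟩

/-- A derivable sequent `!A₁, …, !Aₙ, Π → B` yields `Π → B` in every relation for which formulae
of the sequent denote the set of contexts deriving them, and which derives each `Aᵢ`. -/
theorem BDeriv.of_mem_interp_iff {D : List Fm → Fm → Prop} {As P : List Fm} {B : Fm}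
    (h : BDeriv (As.map Fm.bang ++ P) B)
    (hAs : ∀ A ∈ As, [] ∈ interp D A) (hP : ∀ A ∈ P, [A] ∈ interp D A)
    (hB : P ∈ interp D B → D P B) : D P B :=
  hB (h.sound D (append_mem_interpCtx (nil_mem_interpCtx_map_bang hAs) (self_mem_interpCtx hP)))

/-- Modalised deduction theorem, backward direction: if `A₁, …, Aₙ` and `Π → B` are
product-free and `!A₁, …, !Aₙ, Π → B` is derivable in `!L^Λ(∧,0,1)`, then `Π → B` is
derivable from the hypotheses `{Λ → A₁, …, Λ → Aₙ}` in the product-free fragment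
`L^Λ_{\,/}(∧,0,1)`; moreover, if all of `A₁, …, Aₙ, Π, B` contain no constants, then
`Π → B` is derivable from these hypotheses in `L^Λ_{\,/}(∧)`. -/
theorem modalised_deduction_backward (As : List Fm) (P : List Fm) (B : Fm)
    (hAs : ∀ A ∈ As, ProdFree A)
    (hP : ∀ A ∈ P, ProdFree A) (hB : ProdFree B)
    (h : BDeriv (List.map Fm.bang As ++ P) B) :
    DerivPF {s | ∃ A ∈ As, s = (([] : List Fm), A)} P B ∧
    ((∀ A ∈ As, ConstFree A) → (∀ A ∈ P, ConstFree A) → ConstFree B →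
      DerivPFNC {s | ∃ A ∈ As, s = (([] : List Fm), A)} P B) := by
  constructor
  · have key {A : Fm} (hA : ProdFree A) {Γ : List Fm} :=
      mem_interp_iff (D := DerivPF {s | ∃ A ∈ As, s = (([] : List Fm), A)}) .id .cut .ldivL
        .ldivR .rdivL .rdivR .andL1 .andL2 .andR (A := A) (.inr ⟨.oneR, .zeroL, .oneL⟩) hA
        (Γ := Γ)
    exact h.of_mem_interp_iff (fun A hA => (key (hAs A hA)).2 (.hyp ⟨A, hA, rfl⟩))
      (fun A hA => (key (hP A hA)).2 (.id A)) (key hB).1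
  · intro cAs cP cB
    have key {A : Fm} (hA : ProdFree A) (hc : ConstFree A) {Γ : List Fm} :=
      mem_interp_iff (D := DerivPFNC {s | ∃ A ∈ As, s = (([] : List Fm), A)}) .id .cut .ldivL
        .ldivR .rdivL .rdivR .andL1 .andL2 .andR (A := A) (.inl hc) hA (Γ := Γ)
    exact h.of_mem_interp_iff (fun A hA => (key (hAs A hA) (cAs A hA)).2 (.hyp ⟨A, hA, rfl⟩))
      (fun A hA => (key (hP A hA) (cP A hA)).2 (.id A)) (key hB cB).1
end
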